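/- Let B be an instance of (2,2)-E3-SAT and let J be the TAP-SS instance constructed from B as described. If B admits a satisfying truth assignment, then J admits an applicant-complete stable matching. -/

import Mathlib

/-- The three subjects. -/
inductive Subj : Type where
  | F | I | M
deriving DecidableEq

/-- An instance of (2,2)-E3-SAT with variables `Fin n` and clauses `Fin m`:
`clause j t` is the literal (variable, polarity) in position `t` of clause `j`;
`occurs v b o` is the (clause, position) of the `o`-th occurrence of the literal
`(v, b)`, and `occInv` is its two-sided inverse, so that each clause has exactly
3 literals and each literal occurs exactly twice. -/
structure E3SAT (n m : ℕ) where
  clause : Fin m → Fin 3 → Fin n × Bool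
  occurs : Fin n → Bool → Fin 2 → Fin m × Fin 3
  occInv : Fin m → Fin 3 → Fin n × Bool × Fin 2
  clause_occurs : ∀ v b o, clause (occurs v b o).1 (occurs v b o).2 = (v, b)
  occurs_occInv : ∀ j t, occurs (occInv j t).1 (occInv j t).2.1 (occInv j t).2.2 = (j, t)
  occInv_occurs : ∀ v b o, occInv (occurs v b o).1 (occurs v b o).2 = (v, b, o)

/-- `f` is a satisfying truth assignment of `B`. -/
def E3SAT.Satisfies {n m : ℕ} (B : E3SAT n m) (f : Fin n → Bool) : Prop :=
  ∀ j : Fin m, ∃ t : Fin 3, f (B.clause j t).1 = (B.clause j t).2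
/-- An instance of TAP-SS: like TAP but each school has a separate preference
list of applicants for each subject. -/
structure TAPSS (A : Type*) (S : Type*) (P : Type*) where
  ptype : A → Finset P
  prefA : A → List S
  cap : S → P → ℕ
  prefSp : S → P → List A

namespace TAPSS

variable {A S P : Type*} [DecidableEq A] [DecidableEq S] [DecidableEq P] (J : TAPSS A S P)

def IsAssignment (M : Finset (A × S)) : Prop :=
  (∀ x ∈ M, x.2 ∈ J.prefA x.1) ∧
  ∀ a s s', (a, s) ∈ M → (a, s') ∈ M → s = s'

def Mp (M : Finset (A × S)) (s : S) (p : P) : Finset A :=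
  (M.filter (fun x => x.2 = s ∧ p ∈ J.ptype x.1)).image Prod.fst

def Mpr (M : Finset (A × S)) (s : S) (p r : P) : Finset A :=
  (M.filter (fun x => x.2 = s ∧ J.ptype x.1 = {p, r})).image Prod.fst

def IsMatching (M : Finset (A × S)) : Prop :=
  J.IsAssignment M ∧ ∀ s p, (J.Mp M s p).card ≤ J.cap s p

def Undersub (M : Finset (A × S)) (s : S) (p : P) : Prop :=
  (J.Mp M s p).card < J.cap s p

def PrefersA (a : A) (s s' : S) : Prop :=
  s ∈ J.prefA a ∧ s' ∈ J.prefA a ∧ (J.prefA a).idxOf s < (J.prefA a).idxOf s'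

/-- School `s` prefers `a` to `a'` in subject `p`. -/
def PrefersS (s : S) (p : P) (a a' : A) : Prop :=
  a ∈ J.prefSp s p ∧ a' ∈ J.prefSp s p ∧
    (J.prefSp s p).idxOf a < (J.prefSp s p).idxOf a'

def Unassigned (M : Finset (A × S)) (a : A) : Prop := ∀ s, (a, s) ∉ M

def Blocks (M : Finset (A × S)) (a : A) (s : S) : Prop :=
  s ∈ J.prefA a ∧
  (Unassigned M a ∨ ∃ s', (a, s') ∈ M ∧ J.PrefersA a s s') ∧
  ∃ p₁ p₂, p₁ ≠ p₂ ∧ J.ptype a = {p₁, p₂} ∧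
    ((J.Undersub M s p₁ ∧ J.Undersub M s p₂) ∨
     (J.Undersub M s p₁ ∧ ∃ b ∈ J.Mp M s p₂, J.PrefersS s p₂ a b) ∨
     (J.Undersub M s p₂ ∧ ∃ b ∈ J.Mp M s p₁, J.PrefersS s p₁ a b) ∨
     (∃ b ∈ J.Mpr M s p₁ p₂, J.PrefersS s p₁ a b ∧ J.PrefersS s p₂ a b) ∨
     (∃ b₁ ∈ J.Mp M s p₁, ∃ b₂ ∈ J.Mp M s p₂,
        b₁ ≠ b₂ ∧ J.PrefersS s p₁ a b₁ ∧ J.PrefersS s p₂ a b₂))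

def Stable (M : Finset (A × S)) : Prop :=
  J.IsMatching M ∧ ∀ a s, ¬ J.Blocks M a s

/-- Every applicant is assigned. -/
def ApplicantComplete (_J : TAPSS A S P) (M : Finset (A × S)) : Prop :=
  ∀ a : A, ∃ s, (a, s) ∈ M

end TAPSS
/-- The applicants of the TAP-SS instance constructed from a (2,2)-E3-SAT instance:
`x i r` is the applicant `x_{4i+r}` of the paper, `q j` is `q_{j+1}` and
`w j t` is `w_{j+1}^{t+1}`. -/
inductive SApp (n m : ℕ) : Type where
  | x (i : Fin n) (r : Fin 4)
  | q (j : Fin m)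
  | w (j : Fin m) (t : Fin 3)
deriving DecidableEq

/-- The schools of the TAP-SS instance constructed from a (2,2)-E3-SAT instance:
`y i r` is the school `y_{4i+r}` of the paper, `s j t` is `s_{j+1}^{t+1}` and
`s4 j` is `s_{j+1}^4`. -/
inductive SSch (n m : ℕ) : Type where
  | y (i : Fin n) (r : Fin 4)
  | s (j : Fin m) (t : Fin 3)
  | s4 (j : Fin m)
deriving DecidableEq

variable {n m : ℕ}

/-- The school `s(x_{4i+r})` housing the literal occurrence that applicant
`x_{4i+r}` corresponds to. -/
def sx (B : E3SAT n m) (i : Fin n) (r : Fin 4) : SSch n m :=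
  if h : r.1 < 2 then
    SSch.s (B.occurs i true ⟨r.1, h⟩).1 (B.occurs i true ⟨r.1, h⟩).2
  else
    SSch.s (B.occurs i false ⟨r.1 - 2, by have := r.2; omega⟩).1
      (B.occurs i false ⟨r.1 - 2, by have := r.2; omega⟩).2

open Subj in
/-- Types of the applicants: all x-applicants are FI, all q- and w-applicants are FM. -/
def ssPtype : SApp n m → Finset Subj
  | .x _ _ => {F, I}
  | .q _ => {F, M}
  | .w _ _ => {F, M}

/-- Preference lists of the applicants. -/
def ssPrefA (B : E3SAT n m) : SApp n m → List (SSch n m)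
  | .x i r =>
      if r = 0 then [.y i 0, sx B i r, .y i 1]
      else if r = 1 then [.y i 1, sx B i r, .y i 2]
      else if r = 2 then [.y i 3, sx B i r, .y i 2]
      else [.y i 0, sx B i r, .y i 3]
  | .q j => [.s j 0, .s j 1, .s j 2]
  | .w j t => [.s j t, .s4 j]

open Subj in
/-- Capacities of the schools. -/
def ssCap : SSch n m → Subj → ℕ
  | .y _ _, p => if p = M then 0 else 1
  | .s _ _, _ => 1
  | .s4 _, p => if p = I then 0 else 1

/-- `⟨X⟩`: the x-applicants in increasing subscript order. -/
def Xlist (n m : ℕ) : List (SApp n m) :=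
  (List.finRange n).flatMap fun i => (List.finRange 4).map fun r => SApp.x i r

/-- `⟨Q⟩`: the q-applicants in increasing subscript order. -/
def Qlist (n m : ℕ) : List (SApp n m) := (List.finRange m).map SApp.q

/-- `⟨W⟩`: the w-applicants ordered by increasing subscript and, within equal
subscript, increasing superscript. -/
def Wlist (n m : ℕ) : List (SApp n m) :=
  (List.finRange m).flatMap fun j => (List.finRange 3).map fun t => SApp.w j t

open Subj in
/-- The subject-specific master lists of applicants:
F: ⟨W⟩ ⟨X⟩ ⟨Q⟩; I: ⟨X̄⟩; M: ⟨Q⟩ ⟨W̄⟩. -/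
def ssMaster (n m : ℕ) : Subj → List (SApp n m)
  | F => Wlist n m ++ Xlist n m ++ Qlist n m
  | I => (Xlist n m).reverse
  | M => Qlist n m ++ (Wlist n m).reverse

/-- The TAP-SS instance `J` constructed from the (2,2)-E3-SAT instance `B`;
each school's preference list for subject `p` is the restriction of the master
list for `p` to the applicants whose type includes `p` and who find the school
acceptable. -/
def ssOf (B : E3SAT n m) : TAPSS (SApp n m) (SSch n m) Subj where
  ptype := ssPtype
  prefA := ssPrefA B
  cap s p := ssCap s p
  prefSp s p := (ssMaster n m p).filter
    (fun a => decide (s ∈ ssPrefA B a) && decide (p ∈ ssPtype a))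

/-- The set of pairs `T_i = {(x_{4i+r}, y_{4i+r}) : 0 ≤ r ≤ 3}`. -/
def ssT (i : Fin n) : Finset (SApp n m × SSch n m) :=
  {(.x i 0, .y i 0), (.x i 1, .y i 1), (.x i 2, .y i 2), (.x i 3, .y i 3)}

/-- The set of pairs `F_i = {(x_{4i+r}, y_{4i+r+1}) : 0 ≤ r ≤ 2} ∪ {(x_{4i+3}, y_{4i})}`. -/
def ssF (i : Fin n) : Finset (SApp n m × SSch n m) :=
  {(.x i 0, .y i 1), (.x i 1, .y i 2), (.x i 2, .y i 3), (.x i 3, .y i 0)}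

/-- A matching that is the graph of an injective function is stable if every school an applicant
would rather attend holds an applicant it does not rank below them in some shared subject of
capacity one. -/
theorem TAPSS.stable_of_graph {A S P : Type*} [DecidableEq A] [DecidableEq S] [DecidableEq P]
    (J : TAPSS A S P) (M : Finset (A × S)) (g : A → S) (hM : ∀ a s, (a, s) ∈ M ↔ g a = s)
    (hg : Function.Injective g) (hacc : ∀ a, g a ∈ J.prefA a)
    (hcap : ∀ a, ∀ p ∈ J.ptype a, 1 ≤ J.cap (g a) p)
    (hpref : ∀ a s, J.PrefersA a s (g a) → ∃ b, g b = s ∧ ∃ p ∈ J.ptype a, p ∈ J.ptype b ∧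
      J.cap s p = 1 ∧ ¬ J.PrefersS s p a b) :
    J.Stable M := by
  have hMp : ∀ a s p, a ∈ J.Mp M s p ↔ g a = s ∧ p ∈ J.ptype a := by
    intro a s p
    simp only [TAPSS.Mp, Finset.mem_image, Finset.mem_filter, Prod.exists]
    constructor
    · rintro ⟨a, s', ⟨h, rfl, hp⟩, rfl⟩
      exact ⟨(hM _ _).1 h, hp⟩
    · rintro ⟨h, hp⟩
      exact ⟨a, s, ⟨(hM _ _).2 h, rfl, hp⟩, rfl⟩
  have hMpr : ∀ a s p r, a ∈ J.Mpr M s p r → g a = s := by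
    intro a s p r
    simp only [TAPSS.Mpr, Finset.mem_image, Finset.mem_filter, Prod.exists]
    rintro ⟨a, s', ⟨h, rfl, -⟩, rfl⟩
    exact (hM _ _).1 h
  refine ⟨⟨⟨fun x hx => ?_, fun a s s' h h' => ?_⟩, fun s p => ?_⟩, ?_⟩
  · rw [← (hM x.1 x.2).1 hx]
    exact hacc _
  · rw [← (hM _ _).1 h, (hM _ _).1 h']
  · rcases (J.Mp M s p).eq_empty_or_nonempty with h | ⟨a, ha⟩
    · simp [h]
    · obtain ⟨rfl, hp⟩ := (hMp _ _ _).1 ha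
      refine le_trans (Finset.card_le_one.2 fun b hb c hc => hg ?_) (hcap a p hp)
      rw [((hMp _ _ _).1 hb).1, ((hMp _ _ _).1 hc).1]
  · rintro a s ⟨-, hbetter, p₁, p₂, -, htype, hcases⟩
    have hprefers : J.PrefersA a s (g a) := by
      rcases hbetter with h | ⟨s', h, h'⟩
      · exact absurd ((hM _ _).2 rfl) (h (g a))
      · rwa [(hM _ _).1 h]
    obtain ⟨b, hb, p, hpa, hpb, hc, hnot⟩ := hpref a s hprefers
    have hfull : ¬ J.Undersub M s p := by
      have : 0 < (J.Mp M s p).card := Finset.card_pos.2 ⟨b, (hMp _ _ _).2 ⟨hb, hpb⟩⟩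
      unfold TAPSS.Undersub
      omega
    have hno : ∀ c, g c = s → ¬ J.PrefersS s p a c := fun c hc' => by
      rwa [hg (hc'.trans hb.symm)]
    have hno' : ∀ c ∈ J.Mp M s p, ¬ J.PrefersS s p a c := fun c hc' =>
      hno c ((hMp _ _ _).1 hc').1
    rw [htype, Finset.mem_insert, Finset.mem_singleton] at hpa
    rcases hcases with ⟨h₁, h₂⟩ | ⟨h₁, c, hc, h₂⟩ | ⟨h₁, c, hc, h₂⟩ | ⟨c, hc, h₁, h₂⟩ |
      ⟨c₁, hc₁, c₂, hc₂, -, h₁, h₂⟩ <;> rcases hpa with rfl | rfl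
    · exact hfull h₁
    · exact hfull h₂
    · exact hfull h₁
    · exact hno' c hc h₂
    · exact hno' c hc h₂
    · exact hfull h₁
    · exact hno c (hMpr _ _ _ _ hc) h₁
    · exact hno c (hMpr _ _ _ _ hc) h₂
    · exact hno' c₁ hc₁ h₁
    · exact hno' c₂ hc₂ h₂

theorem List.Pairwise.rel_of_idxOf_lt {α : Type*} [DecidableEq α] {R : α → α → Prop} {l : List α}
    (h : l.Pairwise R) {a b : α} (hb : b ∈ l) (hab : l.idxOf a < l.idxOf b) : R a b := by
  have hb' := List.idxOf_lt_length_of_mem hb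
  have := List.pairwise_iff_getElem.1 h _ _ (hab.trans hb') hb' hab
  simpa using this

/-- A weak rank along which each master list is sorted. -/
def ssRank : Subj → SApp n m → ℤ
  | .F, .w _ _ => 0
  | .F, .x i r => 4 * i.1 + r.1 + 1
  | .F, .q _ => 4 * n + 1
  | .I, .x i r => -(4 * i.1 + r.1)
  | .I, _ => 0
  | .M, .q _ => 0
  | .M, _ => 1

theorem mem_Wlist {a : SApp n m} : a ∈ Wlist n m ↔ ∃ j t, a = .w j t := by
  simp [Wlist, eq_comm]

theorem mem_Xlist {a : SApp n m} : a ∈ Xlist n m ↔ ∃ i r, a = .x i r := by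
  simp [Xlist, eq_comm]

theorem mem_Qlist {a : SApp n m} : a ∈ Qlist n m ↔ ∃ j, a = .q j := by
  simp [Qlist, eq_comm]

theorem pairwise_Xlist :
    (Xlist n m).Pairwise fun a b => ssRank .F a ≤ ssRank .F b ∧ ssRank .I b ≤ ssRank .I a := by
  rw [Xlist, List.pairwise_flatMap]
  constructor
  · intro i _
    rw [List.pairwise_map]
    refine (List.pairwise_lt_finRange 4).imp fun {r r'} h => ?_
    have := Fin.lt_def.1 h
    simp only [ssRank]
    omega
  · refine (List.pairwise_lt_finRange n).imp fun {i i'} h => ?_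
    have := Fin.lt_def.1 h
    simp only [List.mem_map]
    rintro _ ⟨r, -, rfl⟩ _ ⟨r', -, rfl⟩
    simp only [ssRank]
    omega

theorem pairwise_ssMaster (p : Subj) :
    (ssMaster n m p).Pairwise fun a b => ssRank p a ≤ ssRank p b := by
  cases p with
  | F =>
    simp only [ssMaster, List.pairwise_append, List.mem_append, mem_Wlist, mem_Xlist, mem_Qlist]
    refine ⟨⟨List.pairwise_of_forall_mem_list ?_, pairwise_Xlist.imp And.left, ?_⟩,
      List.pairwise_of_forall_mem_list ?_, ?_⟩
    · simp only [mem_Wlist]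
      rintro _ ⟨j, t, rfl⟩ _ ⟨j', t', rfl⟩
      exact le_rfl
    · rintro _ ⟨j, t, rfl⟩ _ ⟨i, r, rfl⟩
      simp only [ssRank]
      omega
    · simp only [mem_Qlist]
      rintro _ ⟨j, rfl⟩ _ ⟨j', rfl⟩
      exact le_rfl
    · rintro _ (⟨j, t, rfl⟩ | ⟨i, r, rfl⟩) _ ⟨j', rfl⟩ <;> simp only [ssRank] <;> omega
  | I =>
    rw [ssMaster, List.pairwise_reverse]
    exact pairwise_Xlist.imp And.right
  | M =>
    simp only [ssMaster, List.pairwise_append, List.mem_reverse, mem_Wlist, mem_Qlist]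
    refine ⟨List.pairwise_of_forall_mem_list ?_, List.pairwise_of_forall_mem_list ?_, ?_⟩
    · simp only [mem_Qlist]
      rintro _ ⟨j, rfl⟩ _ ⟨j', rfl⟩
      exact le_rfl
    · simp only [List.mem_reverse, mem_Wlist]
      rintro _ ⟨j, t, rfl⟩ _ ⟨j', t', rfl⟩
      exact le_rfl
    · rintro _ ⟨j, rfl⟩ _ ⟨j', t', rfl⟩
      simp [ssRank]

theorem not_prefersS_of_ssRank_lt (B : E3SAT n m) {s : SSch n m} {p : Subj} {a b : SApp n m}
    (h : ssRank p b < ssRank p a) : ¬ (ssOf B).PrefersS s p a b := by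
  rintro ⟨-, hb, hab⟩
  exact h.not_ge (((pairwise_ssMaster p).filter _).rel_of_idxOf_lt hb hab)

theorem exists_sx_eq (B : E3SAT n m) (i : Fin n) (r : Fin 4) :
    ∃ j k, sx B i r = .s j k ∧ B.clause j k = (i, decide (r.1 < 2)) := by
  unfold sx
  split_ifs with h
  · exact ⟨_, _, rfl, by simp [B.clause_occurs, h]⟩
  · exact ⟨_, _, rfl, by simp [B.clause_occurs, h]⟩

/-- The assignment determined by the truth assignment `f` and the choice `t j` of a literal
position in each clause: `T_i` or `F_i` according to the value of variable `i`, while `q_j` takes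
the chosen position and displaces the corresponding `w`-applicant. -/
def ssAssign (f : Fin n → Bool) (t : Fin m → Fin 3) : SApp n m → SSch n m
  | .x i r => if f i then .y i r else .y i (r + 1)
  | .q j => .s j (t j)
  | .w j k => if k = t j then .s4 j else .s j k

theorem ssAssign_injective (f : Fin n → Bool) (t : Fin m → Fin 3) :
    Function.Injective (ssAssign f t) := by
  rintro (⟨i, r⟩ | j | ⟨j, k⟩) (⟨i', r'⟩ | j' | ⟨j', k'⟩) h <;> simp only [ssAssign] at h <;>
    grind

theorem ssAssign_mem_ssPrefA (B : E3SAT n m) (f : Fin n → Bool) (t : Fin m → Fin 3)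
    (a : SApp n m) : ssAssign f t a ∈ ssPrefA B a := by
  rcases a with ⟨i, r⟩ | j | ⟨j, k⟩
  · cases hi : f i <;> fin_cases r <;> simp [ssAssign, ssPrefA, hi]
  · have : ∀ k : Fin 3, k = 0 ∨ k = 1 ∨ k = 2 := by decide
    simpa [ssAssign, ssPrefA] using this (t j)
  · by_cases h : k = t j <;> simp [ssAssign, ssPrefA, h]

theorem one_le_ssCap_ssAssign (f : Fin n → Bool) (t : Fin m → Fin 3) (a : SApp n m) (p : Subj)
    (hp : p ∈ ssPtype a) : 1 ≤ ssCap (ssAssign f t a) p := by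
  rcases a with ⟨i, r⟩ | j | ⟨j, k⟩ <;> cases p <;> simp [ssPtype] at hp <;>
    simp only [ssAssign] <;> (try split_ifs) <;> simp [ssCap]

theorem ssAssign_not_preferred (B : E3SAT n m) (f : Fin n → Bool) (t : Fin m → Fin 3)
    (ht : ∀ j, f (B.clause j (t j)).1 = (B.clause j (t j)).2) (a : SApp n m) (s : SSch n m)
    (h : (ssOf B).PrefersA a s (ssAssign f t a)) :
    ∃ b, ssAssign f t b = s ∧ ∃ p ∈ ssPtype a, p ∈ ssPtype b ∧ ssCap s p = 1 ∧
      ¬ (ssOf B).PrefersS s p a b := by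
  obtain ⟨hs, -, hlt⟩ := h
  simp only [ssOf] at hs hlt
  rcases a with ⟨i, r⟩ | j | ⟨j, k⟩
  · obtain ⟨j, k, hsx, hcl⟩ := exists_sx_eq B i r
    have hq : s = .s j k → f i ≠ decide (r.1 < 2) → ∃ b, ssAssign f t b = s ∧
        ∃ p ∈ ssPtype (SApp.x i r : SApp n m), p ∈ ssPtype b ∧ ssCap s p = 1 ∧
          ¬ (ssOf B).PrefersS s p (.x i r) b := by
      rintro rfl hfi
      have hk : k ≠ t j := by
        rintro rfl
        have := ht j
        rw [hcl] at this
        exact hfi this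
      refine ⟨.w j k, by simp [ssAssign, hk], .F, by simp [ssPtype], by simp [ssPtype],
        by simp [ssCap], not_prefersS_of_ssRank_lt B ?_⟩
      simp only [ssRank]
      omega
    have hy : ∀ r' r'' : Fin 4, s = .y i r' → (if f i then r'' = r' else r'' + 1 = r') →
        r'' ≠ r → ∃ b, ssAssign f t b = s ∧
        ∃ p ∈ ssPtype (SApp.x i r : SApp n m), p ∈ ssPtype b ∧ ssCap s p = 1 ∧
          ¬ (ssOf B).PrefersS s p (.x i r) b := by
      rintro r' r'' rfl hr hne
      refine ⟨.x i r'', ?_, ?_⟩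
      · simp only [ssAssign]
        split_ifs at hr ⊢ <;> rw [hr]
      · rcases lt_or_gt_of_ne hne with hlt | hlt
        · refine ⟨.F, by simp [ssPtype], by simp [ssPtype], by simp [ssCap],
            not_prefersS_of_ssRank_lt B ?_⟩
          have := Fin.lt_def.1 hlt
          simp only [ssRank]
          omega
        · refine ⟨.I, by simp [ssPtype], by simp [ssPtype], by simp [ssCap],
            not_prefersS_of_ssRank_lt B ?_⟩
          have := Fin.lt_def.1 hlt
          simp only [ssRank]
          omega
    have hne : s ≠ ssAssign f t (.x i r) := by
      rintro rfl
      exact lt_irrefl _ hlt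
    have hcases : (s = sx B i r ∧ f i ≠ decide (r.1 < 2)) ∨
        ∃ r' r'' : Fin 4, s = .y i r' ∧ (if f i then r'' = r' else r'' + 1 = r') ∧ r'' ≠ r := by
      clear hq hy
      cases hi : f i <;> fin_cases r <;>
        simp [ssPrefA, ssAssign, hi] at hs hlt hne ⊢ <;>
        rcases hs with rfl | rfl | rfl <;> simp_all <;> decide
    rcases hcases with ⟨hs', hfi⟩ | ⟨r', r'', hs', hr, hr'⟩
    · exact hq (hs'.trans hsx) hfi
    · exact hy r' r'' hs' hr hr'
  · have hk : ∃ k, s = .s j k := by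
      simp only [ssPrefA, List.mem_cons, List.not_mem_nil, or_false] at hs
      rcases hs with rfl | rfl | rfl <;> exact ⟨_, rfl⟩
    obtain ⟨k, rfl⟩ := hk
    have hk : k ≠ t j := by
      rintro rfl
      exact lt_irrefl _ hlt
    refine ⟨.w j k, by simp [ssAssign, hk], .F, by simp [ssPtype], by simp [ssPtype],
      by simp [ssCap], not_prefersS_of_ssRank_lt B ?_⟩
    simp only [ssRank]
    omega
  · by_cases hk : k = t j
    · have hs' : s = .s j k := by
        simp only [ssPrefA, List.mem_cons, List.not_mem_nil, or_false] at hs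
        rcases hs with rfl | rfl
        · rfl
        · simp [ssAssign, hk] at hlt
      subst hs'
      refine ⟨.q j, by simp [ssAssign, hk], .M, by simp [ssPtype], by simp [ssPtype],
        by simp [ssCap], not_prefersS_of_ssRank_lt B ?_⟩
      simp [ssRank]
    · simp [ssAssign, ssPrefA, hk] at hlt

theorem stmt10 {n m : ℕ} (B : E3SAT n m) (f : Fin n → Bool) (hf : B.Satisfies f) :
    ∃ M : Finset (SApp n m × SSch n m),
      (ssOf B).Stable M ∧ (ssOf B).ApplicantComplete M := by
  choose t ht using hf
  have hM : ∀ a s, (a, s) ∈ ((Wlist n m ++ Xlist n m ++ Qlist n m).map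
      fun a => (a, ssAssign f t a)).toFinset ↔ ssAssign f t a = s := by
    intro a s
    have ha : a ∈ Wlist n m ++ Xlist n m ++ Qlist n m := by
      cases a <;> simp [mem_Wlist, mem_Xlist, mem_Qlist]
    rw [List.mem_toFinset, List.mem_map]
    constructor
    · rintro ⟨b, -, hb⟩
      cases hb
      rfl
    · rintro rfl
      exact ⟨a, ha, rfl⟩
  exact ⟨_, (ssOf B).stable_of_graph _ (ssAssign f t) hM (ssAssign_injective f t)
    (ssAssign_mem_ssPrefA B f t) (one_le_ssCap_ssAssign f t) (ssAssign_not_preferred B f t ht),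
    fun a => ⟨_, (hM a _).2 rfl⟩⟩
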